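/- Let q ≥ 1 and n ≥ 2 be integers and let X be a connected (q+1)-regular simple undirected graph on n vertices. Suppose μ(X) > 2, and let β > 1 be the unique real number with β + β^{−1} = μ(X). Then there exists an integer m with 1 ≤ m ≤ n−1 such that H_{2k}/β^{2k} converges to −m as k → ∞. -/

import Mathlib

open Matrix Filter

noncomputable section

/-- The non-backtracking (Hashimoto) matrix of a graph, indexed by darts:
`W e f = 1` if the end of `e` is the start of `f` and `f` is not the reversal of `e`. -/
def hashimoto {n : ℕ} (X : SimpleGraph (Fin n)) [DecidableRel X.Adj] :
    Matrix X.Dart X.Dart ℝ :=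
  Matrix.of fun e f => if e.toProd.2 = f.toProd.1 ∧ f ≠ e.symm then 1 else 0

/-- `N_k = trace(W^k)`, the number of geodesic cycles of length `k`. -/
def Ngc {n : ℕ} (X : SimpleGraph (Fin n)) [DecidableRel X.Adj] (k : ℕ) : ℝ :=
  (hashimoto X ^ k).trace

/-- The sequence `H_k`. -/
def Hseq (q : ℕ) {n : ℕ} (X : SimpleGraph (Fin n)) [DecidableRel X.Adj] (k : ℕ) : ℝ :=
  if Odd k then
    2 * ((n : ℝ) - 1) + Real.sqrt q ^ k + (Real.sqrt q ^ k)⁻¹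
      - (Real.sqrt q ^ k)⁻¹ * Ngc X k
  else
    2 * ((n : ℝ) - 1) + Real.sqrt q ^ k + (Real.sqrt q ^ k)⁻¹
      - (Real.sqrt q ^ k)⁻¹ * (Ngc X k - (n : ℝ) * ((q : ℝ) - 1))

/-- `μ(X) = q^{-1/2} · max_{2 ≤ i ≤ n} |λ_i|`, where `lam` enumerates the eigenvalues
in decreasing order (indices starting from `0`). -/
def mu (q : ℕ) {n : ℕ} (lam : Fin n → ℝ) : ℝ :=
  (Real.sqrt q)⁻¹ * sSup {x : ℝ | ∃ i : Fin n, (i : ℕ) ≠ 0 ∧ x = |lam i|}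

/-- If `B * P = P * K`, then the traces of the powers of `B + P * R` and `K + R * P` differ from
those of `B` and `K` by the same amount. -/
theorem trace_pow_add_mul_sub_trace_pow {ι κ : Type*} [Fintype ι] [DecidableEq ι] [Fintype κ]
    [DecidableEq κ] {B : Matrix ι ι ℝ} {P : Matrix ι κ ℝ} {R : Matrix κ ι ℝ} {K : Matrix κ κ ℝ}
    (h : B * P = P * K) (k : ℕ) :
    ((B + P * R) ^ k).trace - (B ^ k).trace = ((K + R * P) ^ k).trace - (K ^ k).trace := by
  have hcomm : ∀ k : ℕ, (B + P * R) ^ k * P = P * (K + R * P) ^ k := by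
    intro k
    induction k with
    | zero => simp
    | succ k ih =>
      have hBPR : (B + P * R) * P = P * (K + R * P) := by
        rw [Matrix.add_mul, Matrix.mul_add, h, Matrix.mul_assoc]
      rw [pow_succ, Matrix.mul_assoc, hBPR, ← Matrix.mul_assoc, ih, Matrix.mul_assoc, ← pow_succ]
  have hfactor : ∃ Y : Matrix κ ι ℝ,
      (B + P * R) ^ k - B ^ k = P * Y ∧ (K + R * P) ^ k - K ^ k = Y * P := by
    induction k with
    | zero => exact ⟨0, by simp⟩
    | succ k ih =>
      obtain ⟨Y, hB, hK⟩ := ih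
      refine ⟨Y * B + (K + R * P) ^ k * R, ?_, ?_⟩
      · calc (B + P * R) ^ (k + 1) - B ^ (k + 1)
            = ((B + P * R) ^ k - B ^ k) * B + (B + P * R) ^ k * P * R := by
              simp only [pow_succ, mul_add, sub_mul, Matrix.mul_assoc]; abel
          _ = P * (Y * B + (K + R * P) ^ k * R) := by
              rw [hB, hcomm, Matrix.mul_add, Matrix.mul_assoc, Matrix.mul_assoc]
      · calc (K + R * P) ^ (k + 1) - K ^ (k + 1)
            = ((K + R * P) ^ k - K ^ k) * K + (K + R * P) ^ k * (R * P) := by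
              simp only [pow_succ, mul_add, sub_mul]; abel
          _ = (Y * B + (K + R * P) ^ k * R) * P := by
              rw [hK, Matrix.add_mul, Matrix.mul_assoc Y B P, h, Matrix.mul_assoc, Matrix.mul_assoc]
  obtain ⟨Y, hB, hK⟩ := hfactor
  rw [← trace_sub, ← trace_sub, hB, hK, trace_mul_comm]

open Polynomial in
theorem trace_fromBlocks_pow_eq_trace_aeval_dickson {V : Type*} [Fintype V] [DecidableEq V]
    (A : Matrix V V ℝ) (a : ℝ) (k : ℕ) :
    ((fromBlocks 0 (-1) (a • 1) A : Matrix (V ⊕ V) (V ⊕ V) ℝ) ^ k).trace = (aeval A (dickson 1 a k)).trace := by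
  set M : Matrix (V ⊕ V) (V ⊕ V) ℝ := fromBlocks 0 (-1) (a • 1) A with hM
  have hrec : ∀ k : ℕ, M ^ (k + 2) = fromBlocks A 0 0 A * M ^ (k + 1) - a • M ^ k := by
    intro k
    have h2 : M * M = fromBlocks A 0 0 A * M - a • 1 := by
      rw [eq_sub_iff_add_eq, hM, ← fromBlocks_one, fromBlocks_smul, fromBlocks_multiply,
        fromBlocks_multiply, fromBlocks_add]
      simp
    calc M ^ (k + 2) = M * M * M ^ k := by rw [pow_add, pow_two, ← pow_two, pow_mul_comm]
      _ = _ := by rw [h2, sub_mul, mul_assoc, ← pow_succ']; simp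
  have hblock : ∀ k : ℕ,
      (M ^ k).toBlocks₁₁ + (M ^ k).toBlocks₂₂ = aeval A (dickson 1 a k) := by
    intro k
    induction k using Nat.twoStepInduction with
    | zero =>
      rw [pow_zero, ← fromBlocks_one, toBlocks_fromBlocks₁₁, toBlocks_fromBlocks₂₂, dickson_zero]
      norm_num [one_add_one_eq_two, map_ofNat]
    | one => simp [hM]
    | more k ih ih1 =>
      have hmul : ∀ N : Matrix (V ⊕ V) (V ⊕ V) ℝ,
          (fromBlocks A 0 0 A * N).toBlocks₁₁ + (fromBlocks A 0 0 A * N).toBlocks₂₂ =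
            A * (N.toBlocks₁₁ + N.toBlocks₂₂) := by
        intro N
        conv_lhs => rw [← fromBlocks_toBlocks N, fromBlocks_multiply]
        simp [mul_add]
      have hsub : ∀ N N' : Matrix (V ⊕ V) (V ⊕ V) ℝ,
          (N - a • N').toBlocks₁₁ + (N - a • N').toBlocks₂₂ =
            N.toBlocks₁₁ + N.toBlocks₂₂ - a • (N'.toBlocks₁₁ + N'.toBlocks₂₂) := by
        intro N N'
        ext i j
        simp [toBlocks₁₁, toBlocks₂₂]
        ring
      rw [hrec, hsub, hmul, ih, ih1, dickson_add_two]
      simp [Algebra.smul_def]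
  rw [← hblock, trace_add]
  simp [trace, toBlocks₁₁, toBlocks₂₂]

open Polynomial in
theorem trace_aeval_eq_sum_eval_eigenvalues {V : Type*} [Fintype V] [DecidableEq V]
    {A : Matrix V V ℝ} (hA : A.IsHermitian) (p : ℝ[X]) :
    (aeval A p).trace = ∑ i, p.eval (hA.eigenvalues i) := by
  have hdiag : aeval (diagonal hA.eigenvalues) p =
      diagonal fun i => p.eval (hA.eigenvalues i) := by
    have := aeval_algHom_apply (diagonalAlgHom ℝ : (V → ℝ) →ₐ[ℝ] Matrix V V ℝ) hA.eigenvalues p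
    simp only [diagonalAlgHom_apply] at this
    rw [this]
    congr 1
    ext i
    exact (aeval_algHom_apply (Pi.evalAlgHom ℝ (fun _ : V => ℝ) i) hA.eigenvalues p).symm
  have htrace : ∀ N : Matrix V V ℝ,
      (Unitary.conjStarAlgAut ℝ _ hA.eigenvectorUnitary N).trace = N.trace := by
    intro N
    rw [Unitary.conjStarAlgAut_apply, trace_mul_comm, ← mul_assoc]
    simp
  have hconj := aeval_algHom_apply
    (Unitary.conjStarAlgAut ℝ _ hA.eigenvectorUnitary).toAlgEquiv.toAlgHom
    (diagonal hA.eigenvalues) p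
  calc (aeval A p).trace
      = (aeval (Unitary.conjStarAlgAut ℝ _ hA.eigenvectorUnitary (diagonal hA.eigenvalues))
          p).trace := congrArg (fun N => (aeval N p).trace) hA.spectral_theorem
    _ = (aeval (diagonal hA.eigenvalues) p).trace := (congrArg trace hconj).trans (htrace _)
    _ = ∑ i, p.eval (hA.eigenvalues i) := by rw [hdiag, trace_diagonal]

theorem sum_dart {V : Type*} [Fintype V] [DecidableEq V] (X : SimpleGraph V)
    [DecidableRel X.Adj] (g : V → V → ℝ) :
    ∑ e : X.Dart, g e.fst e.snd = ∑ u, ∑ v, X.adjMatrix ℝ u v * g u v := by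
  rw [← Fintype.sum_prod_type']
  simp only [SimpleGraph.adjMatrix_apply, ite_mul, one_mul, zero_mul]
  rw [← Finset.sum_filter]
  refine Finset.sum_bij' (fun d _ => d.toProd) (fun p hp => ⟨p, (Finset.mem_filter.1 hp).2⟩)
    ?_ ?_ ?_ ?_ ?_ <;> simp

/-- `N_k` for even `k` as a spectral sum. -/
theorem Ngc_even_eq_sum_dickson {q n : ℕ} (X : SimpleGraph (Fin n)) [DecidableRel X.Adj]
    (hreg : X.IsRegularOfDegree (q + 1)) (hA : (X.adjMatrix ℝ).IsHermitian) (k : ℕ) :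
    Ngc X (2 * k) = n * ((q : ℝ) - 1) +
      ∑ i, (Polynomial.dickson 1 (q : ℝ) (2 * k)).eval (hA.eigenvalues i) := by
  set A := X.adjMatrix ℝ with hAdef
  let S : Matrix (Fin n) X.Dart ℝ := of fun v e => if e.fst = v then 1 else 0
  let T : Matrix (Fin n) X.Dart ℝ := of fun v e => if e.snd = v then 1 else 0
  let J : Matrix X.Dart X.Dart ℝ := of fun e f => if f = e.symm then 1 else 0
  let P : Matrix X.Dart (Fin n ⊕ Fin n) ℝ := fromCols Sᵀ Tᵀ
  let R : Matrix (Fin n ⊕ Fin n) X.Dart ℝ := fromRows 0 S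
  let K : Matrix (Fin n ⊕ Fin n) (Fin n ⊕ Fin n) ℝ := fromBlocks 0 (-1) (-1) 0
  have hJ : ∀ {κ : Type} (N : Matrix X.Dart κ ℝ), J * N = of fun e => N e.symm := by
    intro κ N
    ext e v
    simp [J, mul_apply]
  have hJS : J * Sᵀ = Tᵀ := by
    rw [hJ]
    rfl
  have hJT : J * Tᵀ = Sᵀ := by
    rw [hJ]
    rfl
  have hJJ : J * J = 1 := by
    rw [hJ]
    ext e f
    simp [J, one_apply, eq_comm]
  have hSS : S * Sᵀ = ((q : ℝ) + 1) • 1 := by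
    ext u v
    have := sum_dart X fun a _ => (if a = u then (1 : ℝ) else 0) * (if a = v then 1 else 0)
    simp only [S, mul_apply, transpose_apply, of_apply]
    rw [this]
    have hdeg : ∀ u, ∑ v, X.adjMatrix ℝ u v = (q : ℝ) + 1 := by
      intro u
      have := X.adjMatrix_mulVec_const_apply_of_regular (α := ℝ) (a := 1) hreg (v := u)
      simpa [mulVec, dotProduct] using this
    simp only [← Finset.sum_mul, hdeg]
    simp [one_apply, eq_comm]
  have hST : S * Tᵀ = A := by
    ext u v
    have := sum_dart X fun a b => (if a = u then (1 : ℝ) else 0) * (if b = v then 1 else 0)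
    simp only [S, T, mul_apply, transpose_apply, of_apply]
    rw [this]
    simp [hAdef]
  have hBP : -J * P = P * K := by
    simp only [P, K, mul_fromCols, Matrix.neg_mul, hJS, hJT, fromCols_mul_fromBlocks]
    simp
  have hW : hashimoto X = -J + P * R := by
    ext e f
    simp only [P, R, fromCols_mul_fromRows, hashimoto]
    by_cases hf : f = e.symm
    · subst hf
      simp [J, S, T, mul_apply]
    · simp [J, S, T, mul_apply, hf, eq_comm]
  have hM : K + R * P = fromBlocks 0 (-1) ((q : ℝ) • 1) A := by
    simp only [K, R, P, fromRows_mul_fromCols, hSS, hST, fromBlocks_add]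
    simp [add_smul]
  have hKK : K ^ (2 * k) = 1 := by
    rw [pow_mul, pow_two]
    simp [K, fromBlocks_multiply]
  have hBB : (-J) ^ (2 * k) = 1 := by
    rw [pow_mul, pow_two, neg_mul_neg, hJJ, one_pow]
  have hcard : (Fintype.card X.Dart : ℝ) = n * ((q : ℝ) + 1) := by
    rw [X.dart_card_eq_sum_degrees]
    simp [hreg.degree_eq]
  have htr := trace_pow_add_mul_sub_trace_pow (R := R) hBP (2 * k)
  rw [← hW, hM, hKK, hBB, trace_fromBlocks_pow_eq_trace_aeval_dickson,
    trace_aeval_eq_sum_eval_eigenvalues hA, trace_one, trace_one, hcard] at htr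
  simp only [Fintype.card_sum, Fintype.card_fin, Nat.cast_add] at htr
  rw [Ngc]
  linarith

open Polynomial in
theorem dickson_one_sq_eval_mul (s y : ℝ) (k : ℕ) :
    (dickson 1 (s ^ 2) k).eval (s * y) = s ^ k * (dickson 1 1 k).eval y := by
  induction k using Nat.twoStepInduction with
  | zero => simp
  | one => simp
  | more k ih ih1 =>
    simp only [dickson_add_two, eval_sub, eval_mul, eval_X, eval_C, ih, ih1]
    ring

open Polynomial in
theorem dickson_one_one_even_eval_abs (y : ℝ) (k : ℕ) :
    (dickson 1 (1 : ℝ) (2 * k)).eval |y| = (dickson 1 (1 : ℝ) (2 * k)).eval y := by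
  rw [mul_comm 2 k, dickson_one_one_mul]
  simp

open Polynomial in
theorem abs_dickson_one_one_eval_le_two {y : ℝ} (hy : |y| ≤ 2) (k : ℕ) :
    |(dickson 1 (1 : ℝ) k).eval y| ≤ 2 := by
  obtain ⟨h1, h2⟩ := abs_le.1 hy
  have hcos : ∀ (θ : ℝ) (k : ℕ),
      (dickson 1 (1 : ℝ) k).eval (2 * Real.cos θ) = 2 * Real.cos (k * θ) := by
    intro θ k
    induction k using Nat.twoStepInduction with
    | zero => norm_num
    | one => simp
    | more k ih ih1 =>
      simp only [dickson_add_two, eval_sub, eval_mul, eval_X, eval_C, ih, ih1]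
      have e2 : ((k + 2 : ℕ) : ℝ) * θ = ((k + 1 : ℕ) : ℝ) * θ + θ := by push_cast; ring
      have e0 : (k : ℝ) * θ = ((k + 1 : ℕ) : ℝ) * θ - θ := by push_cast; ring
      rw [e2, e0, Real.cos_add, Real.cos_sub]
      ring
  have hyθ : y = 2 * Real.cos (Real.arccos (y / 2)) := by
    rw [Real.cos_arccos (by linarith) (by linarith)]
    ring
  rw [hyθ, hcos, abs_mul, abs_two]
  linarith [Real.abs_cos_le_one (k * Real.arccos (y / 2))]

open Polynomial in
theorem tendsto_dickson_div_pow_of_abs_eq {β y : ℝ} (hβ : 1 < β) (hy : |y| = β + β⁻¹) :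
    Tendsto (fun k : ℕ => (dickson 1 (1 : ℝ) (2 * k)).eval y / β ^ (2 * k)) atTop (nhds 1) := by
  have h0 : β ≠ 0 := by positivity
  have hr : (β⁻¹ / β) ^ 2 < 1 := by
    rw [sq_lt_one_iff₀ (by positivity), div_lt_one (by positivity)]
    exact (inv_lt_one_of_one_lt₀ hβ).trans hβ
  have := (tendsto_pow_atTop_nhds_zero_of_lt_one (by positivity) hr).const_add 1
  rw [add_zero] at this
  refine this.congr fun k => ?_
  rw [← dickson_one_one_even_eval_abs, hy, dickson_one_one_eval_add_inv _ _ (mul_inv_cancel₀ h0),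
    add_div, div_self (pow_ne_zero _ h0), ← div_pow, pow_mul]

open Polynomial in
theorem tendsto_dickson_div_pow_of_abs_lt {β y : ℝ} (hβ : 1 < β) (hy : |y| < β + β⁻¹) :
    Tendsto (fun k : ℕ => (dickson 1 (1 : ℝ) (2 * k)).eval y / β ^ (2 * k)) atTop (nhds 0) := by
  have hβ2 : 1 < β ^ 2 := one_lt_pow₀ hβ two_ne_zero
  rcases le_or_gt |y| 2 with h2 | h2
  · have := (tendsto_pow_atTop_nhds_zero_of_lt_one (r := (β ^ 2)⁻¹) (by positivity)
      (inv_lt_one_of_one_lt₀ hβ2)).const_mul 2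
    rw [mul_zero] at this
    refine squeeze_zero_norm (fun k => ?_) this
    rw [Real.norm_eq_abs, abs_div, abs_of_pos (show 0 < β ^ (2 * k) by positivity), pow_mul,
      inv_pow, div_eq_mul_inv]
    gcongr
    exact abs_dickson_one_one_eval_le_two h2 _
  · obtain ⟨b, hb1, hb⟩ : ∃ b : ℝ, 1 < b ∧ |y| = b + b⁻¹ := by
      have hs := Real.sq_sqrt (show 0 ≤ |y| ^ 2 - 4 by nlinarith)
      have hs0 := Real.sqrt_nonneg (|y| ^ 2 - 4)
      refine ⟨(|y| + √(|y| ^ 2 - 4)) / 2, by linarith, ?_⟩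
      have : |y| + √(|y| ^ 2 - 4) ≠ 0 := by linarith
      field_simp
      nlinarith
    have hbβ : b < β := by
      by_contra! h
      have hinv : β⁻¹ - b⁻¹ = (b - β) * (b⁻¹ * β⁻¹) := by field_simp
      have hle : b⁻¹ * β⁻¹ ≤ 1 :=
        mul_le_one₀ (inv_lt_one_of_one_lt₀ hb1).le (by positivity) (inv_lt_one_of_one_lt₀ hβ).le
      nlinarith
    have hr : (b / β) ^ 2 < 1 := by
      rw [sq_lt_one_iff₀ (by positivity), div_lt_one (by positivity)]
      exact hbβ
    have := (tendsto_dickson_div_pow_of_abs_eq hb1 hb).mul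
      (tendsto_pow_atTop_nhds_zero_of_lt_one (by positivity) hr)
    rw [mul_zero] at this
    refine this.congr fun k => ?_
    have : b ≠ 0 := by positivity
    rw [← pow_mul, div_pow]
    field_simp

theorem abs_eigenvalue_adjMatrix_le {V : Type*} [Fintype V] [DecidableEq V] {X : SimpleGraph V}
    [DecidableRel X.Adj] {d : ℕ} (hreg : X.IsRegularOfDegree d)
    (hA : (X.adjMatrix ℝ).IsHermitian) (i : V) : |hA.eigenvalues i| ≤ d := by
  have hev : Module.End.HasEigenvalue (toLin' (X.adjMatrix ℝ)) (hA.eigenvalues i) := by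
    rw [Module.End.hasEigenvalue_iff_mem_spectrum, spectrum_toLin']
    exact hA.eigenvalues_mem_spectrum_real i
  obtain ⟨v, hv⟩ := eigenvalue_mem_ball hev
  rw [mem_closedBall_iff_norm] at hv
  have hsum : ∑ w ∈ Finset.univ.erase v, ‖X.adjMatrix ℝ v w‖ ≤ d := by
    calc ∑ w ∈ Finset.univ.erase v, ‖X.adjMatrix ℝ v w‖
        ≤ ∑ w, ‖X.adjMatrix ℝ v w‖ :=
          Finset.sum_le_sum_of_subset_of_nonneg (Finset.erase_subset _ _)
            fun _ _ _ => norm_nonneg _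
      _ = ∑ w, X.adjMatrix ℝ v w := by
          refine Finset.sum_congr rfl fun w _ => ?_
          rw [SimpleGraph.adjMatrix_apply]
          split_ifs <;> simp
      _ = d := by
          have := X.adjMatrix_mulVec_const_apply_of_regular (α := ℝ) (a := 1) hreg (v := v)
          simpa [mulVec, dotProduct] using this
  simpa using hv.trans hsum

theorem exists_eigenvalue_adjMatrix_eq {V : Type*} [Fintype V] [DecidableEq V] [Nonempty V]
    {X : SimpleGraph V} [DecidableRel X.Adj] {d : ℕ} (hreg : X.IsRegularOfDegree d)
    (hA : (X.adjMatrix ℝ).IsHermitian) : ∃ i, hA.eigenvalues i = d := by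
  have hev : Module.End.HasEigenvalue (toLin' (X.adjMatrix ℝ)) (d : ℝ) := by
    refine Module.End.hasEigenvalue_of_hasEigenvector (x := Function.const V 1)
      ⟨Module.End.mem_eigenspace_iff.2 ?_, ?_⟩
    · ext v
      rw [toLin'_apply, X.adjMatrix_mulVec_const_apply_of_regular hreg]
      simp
    · exact fun h => one_ne_zero (congrFun h (Classical.arbitrary V))
  rw [Module.End.hasEigenvalue_iff_mem_spectrum, spectrum_toLin',
    hA.spectrum_real_eq_range_eigenvalues] at hev
  exact hev

theorem Hk_asymptotics_of_mu_gt_two {q n : ℕ} (hq : 1 ≤ q) (hn : 2 ≤ n)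
    (X : SimpleGraph (Fin n)) [DecidableRel X.Adj]
    (hconn : X.Connected) (hreg : X.IsRegularOfDegree (q + 1))
    (hA : (X.adjMatrix ℝ).IsHermitian)
    (lam : Fin n → ℝ)
    (hperm : ∃ σ : Equiv.Perm (Fin n), ∀ i, lam i = hA.eigenvalues (σ i))
    (hanti : ∀ i j : Fin n, i ≤ j → lam j ≤ lam i)
    (hmu : 2 < mu q lam)
    (β : ℝ) (hβ : 1 < β) (hβμ : β + β⁻¹ = mu q lam) :
    ∃ m : ℕ, 1 ≤ m ∧ m ≤ n - 1 ∧
      Tendsto (fun k : ℕ => Hseq q X (2 * k) / β ^ (2 * k)) atTop (nhds (-(m : ℝ))) := by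
  obtain ⟨σ, hσ⟩ := hperm
  have : NeZero n := ⟨by omega⟩
  set s : ℝ := Real.sqrt q with hs
  have hs2 : s ^ 2 = q := Real.sq_sqrt (Nat.cast_nonneg q)
  have hs0 : 0 < s := Real.sqrt_pos.2 (by exact_mod_cast hq)
  have hbound : ∀ i, |lam i| ≤ q + 1 := by
    intro i
    rw [hσ]
    exact_mod_cast abs_eigenvalue_adjMatrix_le hreg hA (σ i)
  have hlam0 : lam 0 = q + 1 := by
    obtain ⟨j, hj⟩ := exists_eigenvalue_adjMatrix_eq hreg hA
    refine le_antisymm ((le_abs_self _).trans (hbound 0)) ?_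
    have := hanti 0 (σ.symm j) (Fin.zero_le _)
    rw [hσ (σ.symm j), σ.apply_symm_apply, hj] at this
    exact_mod_cast this
  set E : Set ℝ := {x : ℝ | ∃ i : Fin n, (i : ℕ) ≠ 0 ∧ x = |lam i|} with hE
  have hEfin : E.Finite := (Set.finite_range fun i => |lam i|).subset
    (by rintro x ⟨i, -, rfl⟩; exact ⟨i, rfl⟩)
  have hEne : E.Nonempty := ⟨_, ⟨1, by omega⟩, one_ne_zero, rfl⟩
  have habs : ∀ i, |lam i / s| = s⁻¹ * |lam i| := by
    intro i
    rw [abs_div, abs_of_pos hs0, div_eq_inv_mul]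
  have hle : ∀ i, i ≠ 0 → |lam i / s| ≤ β + β⁻¹ := by
    intro i hi
    rw [habs, hβμ, mu]
    gcongr
    exact le_csSup hEfin.bddAbove ⟨i, Fin.val_ne_zero_iff.2 hi, rfl⟩
  let F : Finset (Fin n) := (Finset.univ.erase 0).filter fun i => |lam i / s| = β + β⁻¹
  have hF : F.Nonempty := by
    obtain ⟨i, hi, hmax⟩ := hEne.csSup_mem hEfin
    refine ⟨i, Finset.mem_filter.2 ⟨Finset.mem_erase.2 ⟨?_, Finset.mem_univ _⟩, ?_⟩⟩
    · rintro rfl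
      simp at hi
    · rw [habs, hβμ, mu, ← hmax]
  refine ⟨F.card, hF.card_pos, (Finset.card_filter_le _ _).trans (by simp), ?_⟩
  let D : ℕ → ℝ → ℝ := fun k y => (Polynomial.dickson 1 (1 : ℝ) (2 * k)).eval y
  have hH : ∀ k : ℕ, Hseq q X (2 * k) / β ^ (2 * k) =
      2 * ((n : ℝ) - 1) * (β ^ (2 * k))⁻¹ -
        ∑ i ∈ Finset.univ.erase 0, D k (lam i / s) / β ^ (2 * k) := by
    intro k
    have hsum : ∑ i, (Polynomial.dickson 1 (q : ℝ) (2 * k)).eval (hA.eigenvalues i) =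
        s ^ (2 * k) * ∑ i, D k (lam i / s) := by
      rw [← Equiv.sum_comp σ, Finset.mul_sum]
      refine Finset.sum_congr rfl fun i _ => ?_
      rw [← hσ, ← hs2, ← dickson_one_sq_eval_mul, mul_div_cancel₀ _ hs0.ne']
    have hD0 : D k (lam 0 / s) = s ^ (2 * k) + (s ^ (2 * k))⁻¹ := by
      have : lam 0 / s = s + s⁻¹ := by
        rw [hlam0, ← hs2]
        field_simp
      simp only [D]
      rw [this, Polynomial.dickson_one_one_eval_add_inv _ _ (mul_inv_cancel₀ hs0.ne'), inv_pow]
    rw [Hseq, if_neg (by simp), Ngc_even_eq_sum_dickson X hreg hA, hsum,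
      ← Finset.add_sum_erase _ _ (Finset.mem_univ (0 : Fin n)), hD0, ← hs, ← Finset.sum_div]
    field_simp
    ring
  have hβinv : Tendsto (fun k : ℕ => 2 * ((n : ℝ) - 1) * (β ^ (2 * k))⁻¹) atTop (nhds 0) := by
    have := (tendsto_pow_atTop_nhds_zero_of_lt_one (r := (β ^ 2)⁻¹) (by positivity)
      (inv_lt_one_of_one_lt₀ (one_lt_pow₀ hβ two_ne_zero))).const_mul (2 * ((n : ℝ) - 1))
    simpa only [mul_zero, inv_pow, ← pow_mul] using this
  have hterms : Tendsto
      (fun k : ℕ => ∑ i ∈ Finset.univ.erase 0, D k (lam i / s) / β ^ (2 * k)) atTop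
      (nhds (∑ i ∈ Finset.univ.erase (0 : Fin n),
        if |lam i / s| = β + β⁻¹ then (1 : ℝ) else 0)) := by
    refine tendsto_finsetSum _ fun i hi => ?_
    split_ifs with h
    · exact tendsto_dickson_div_pow_of_abs_eq hβ h
    · exact tendsto_dickson_div_pow_of_abs_lt hβ
        (lt_of_le_of_ne (hle i (Finset.ne_of_mem_erase hi)) h)
  rw [Finset.sum_boole] at hterms
  simpa only [hH, zero_sub] using hβinv.sub hterms
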